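/- Let P_1,…,P_d ⊂ ℝ^d be nonempty finite point sets that are well-separated, and let α_1,…,α_d be integers with 1 ≤ α_i ≤ |P_i| for all i. Call a colorful selection p = (p_1,…,p_d) with p_i ∈ P_i an α-cut if for every i: |{q ∈ P_i : D_p(q) > 0}| + 1 ≤ α_i ≤ |{q ∈ P_i : D_p(q) ≥ 0}|. Then: (1) every colorful selection p affinely spans a hyperplane of ℝ^d, so the affine map D_p is not identically zero and vanishes exactly on that hyperplane; (2) there exists a colorful selection that is an α-cut; and (3) for any two colorful selections p and p′ that are both α-cuts, the zero sets {x ∈ ℝ^d : D_p(x) = 0} and {x ∈ ℝ^d : D_{p′}(x) = 0} coincide. -/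

import Mathlib

open scoped Matrix

/-- `D_p x`: the determinant of the `d × d` matrix whose `i`-th row is `p i - x`. -/
noncomputable def Dmap {d : ℕ} (p : Fin d → (Fin d → ℝ)) (x : Fin d → ℝ) : ℝ :=
  Matrix.det (Matrix.of fun i j => p i j - x j)

/-- Point sets `P 0, …, P (k-1)` in `ℝ^d` are well-separated: no affine subspace
of dimension at most `k - 2` intersects every convex hull `conv (P i)`. -/
def WellSeparated {d k : ℕ} (P : Fin k → Set (Fin d → ℝ)) : Prop :=
  ¬ ∃ F : AffineSubspace ℝ (Fin d → ℝ),
      (Module.finrank ℝ F.direction : ℤ) ≤ (k : ℤ) - 2 ∧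
      ∀ i, ((F : Set (Fin d → ℝ)) ∩ convexHull ℝ (P i)).Nonempty

/-- The colorful selection `p` is an `α`-cut. -/
def IsAlphaCut {d : ℕ} (P : Fin d → Set (Fin d → ℝ)) (α : Fin d → ℤ)
    (p : Fin d → (Fin d → ℝ)) : Prop :=
  ∀ i : Fin d,
    (({q ∈ P i | 0 < Dmap p q}.ncard : ℤ) + 1 ≤ α i) ∧
    (α i ≤ ({q ∈ P i | 0 ≤ Dmap p q}.ncard : ℤ))

/-- value of the affine function with coefficients `g` -/
noncomputable def affEval {d : ℕ} (g : (Fin d → ℝ) × ℝ) (x : Fin d → ℝ) : ℝ := g.1 ⬝ᵥ x + g.2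

/-- inner product on coefficients -/
noncomputable def affIn {d : ℕ} (g h : (Fin d → ℝ) × ℝ) : ℝ := g.1 ⬝ᵥ h.1 + g.2 * h.2

/-- coefficients of the affine function `Dmap p` -/
noncomputable def coefD {d : ℕ} (p : Fin d → (Fin d → ℝ)) : (Fin d → ℝ) × ℝ :=
  (fun j => Dmap p (Pi.single j 1) - Dmap p 0, Dmap p 0)

theorem Dmap_linear {d : ℕ} (p : Fin d → (Fin d → ℝ)) :
    ∃ L : (Fin d ⊕ Unit → ℝ) →ₗ[ℝ] ℝ, ∀ x, Dmap p x = L (Sum.elim x (fun _ => 1)) := by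
  let M : Matrix (Fin d ⊕ Unit) (Fin d ⊕ Unit) ℝ :=
    Matrix.fromBlocks (Matrix.of p) (Matrix.of fun _ _ => 1) 0 0
  refine ⟨(Matrix.detRowAlternating (R := ℝ) (n := Fin d ⊕ Unit)).toMultilinearMap.toLinearMap
    M (Sum.inr ()), fun x => ?_⟩
  have h1 : Function.update M (Sum.inr ()) (Sum.elim x (fun _ => 1)) =
      Matrix.fromBlocks (Matrix.of p) (Matrix.of fun _ _ => 1)
        (Matrix.of fun _ j => x j) (1 : Matrix Unit Unit ℝ) := by
    ext i j
    rcases i with i | i <;> rcases j with j | j <;> simp [M, Function.update, Matrix.fromBlocks]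
  have h2 : Dmap p x = Matrix.det (Function.update M (Sum.inr ()) (Sum.elim x (fun _ => 1)) :
      Matrix (Fin d ⊕ Unit) (Fin d ⊕ Unit) ℝ) := by
    rw [h1, Matrix.det_fromBlocks_one₂₂]
    unfold Dmap
    congr 1
    ext i j
    simp [Matrix.mul_apply]
  rw [h2]
  rfl

theorem Dmap_eq {d : ℕ} (p : Fin d → (Fin d → ℝ)) (x : Fin d → ℝ) :
    Dmap p x = affEval (coefD p) x := by
  obtain ⟨L, hL⟩ := Dmap_linear p
  have key : ∀ y : Fin d → ℝ, Dmap p y - Dmap p 0 = L (Sum.elim y 0) := by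
    intro y
    rw [hL, hL, ← map_sub]
    congr 1
    ext i
    rcases i with i | i <;> simp
  let E : (Fin d → ℝ) →ₗ[ℝ] (Fin d ⊕ Unit → ℝ) :=
    { toFun := fun y => Sum.elim y 0
      map_add' := by
        intro a b
        ext i
        rcases i with i | i <;> simp
      map_smul' := by
        intro a b
        ext i
        rcases i with i | i <;> simp }
  have hx : Dmap p x - Dmap p 0 = ∑ j, (Dmap p (Pi.single j 1) - Dmap p 0) * x j := by
    rw [key]
    have : L (Sum.elim x 0) = (L ∘ₗ E) x := rfl
    rw [this, LinearMap.pi_apply_eq_sum_univ (L ∘ₗ E) x]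
    refine Finset.sum_congr rfl fun j _ => ?_
    have hs : (fun k => if j = k then (1:ℝ) else 0) = Pi.single j 1 := by
      ext k
      simp [Pi.single_apply, eq_comm]
    rw [key, smul_eq_mul, mul_comm, hs]
    rfl
  unfold affEval coefD
  simp only [dotProduct]
  linarith

theorem continuous_coefD {d : ℕ} : Continuous (coefD (d := d)) := by
  have h : ∀ x : Fin d → ℝ, Continuous fun p : Fin d → (Fin d → ℝ) => Dmap p x := by
    intro x
    unfold Dmap
    apply Continuous.matrix_det
    refine continuous_matrix fun i j => ?_
    simp only [Matrix.of_apply]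
    fun_prop
  unfold coefD
  refine Continuous.prodMk (continuous_pi fun j => (h _).sub (h _)) (h _)

theorem Dmap_self {d : ℕ} (p : Fin d → (Fin d → ℝ)) (i : Fin d) : Dmap p (p i) = 0 :=
  Matrix.det_eq_zero_of_row_eq_zero i (by simp)

theorem affIn_self_pos {d : ℕ} (g : (Fin d → ℝ) × ℝ) (hg : g ≠ 0) : 0 < affIn g g := by
  have h1 : 0 ≤ g.1 ⬝ᵥ g.1 := by
    simp only [dotProduct]
    exact Finset.sum_nonneg fun i _ => mul_self_nonneg _
  have h2 : 0 ≤ g.2 * g.2 := mul_self_nonneg _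
  unfold affIn
  by_contra hc
  apply hg
  have h3 : g.1 ⬝ᵥ g.1 = 0 := by linarith
  have h4 : g.2 * g.2 = 0 := by linarith
  exact Prod.ext (dotProduct_self_eq_zero.1 h3) (mul_self_eq_zero.1 h4)

theorem affineInd_of_ws {d : ℕ} (hd : 0 < d) (P : Fin d → Set (Fin d → ℝ))
    (hws : WellSeparated P) (q : Fin d → (Fin d → ℝ)) (hq : ∀ i, q i ∈ convexHull ℝ (P i)) :
    AffineIndependent ℝ q := by
  obtain ⟨n, rfl⟩ : ∃ n, d = n + 1 := ⟨d - 1, by omega⟩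
  by_contra hc
  have hlt : Module.finrank ℝ (vectorSpan ℝ (Set.range q)) < n := by
    by_contra h
    exact hc ((affineIndependent_iff_le_finrank_vectorSpan ℝ q (n := n) (by simp)).2 (by omega))
  apply hws
  refine ⟨affineSpan ℝ (Set.range q), ?_, fun i => ⟨q i, mem_affineSpan ℝ ⟨i, rfl⟩, hq i⟩⟩
  rw [direction_affineSpan]
  push_cast
  omega

theorem zero_iff_mem {d : ℕ} (q : Fin d → (Fin d → ℝ)) (hq : AffineIndependent ℝ q)
    (x : Fin d → ℝ) : Dmap q x = 0 ↔ x ∈ affineSpan ℝ (Set.range q) := by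
  unfold Dmap
  rw [← Matrix.exists_vecMul_eq_zero_iff]
  have hv : ∀ v : Fin d → ℝ, v ᵥ* (Matrix.of fun i j => q i j - x j) =
      ∑ i, v i • q i - (∑ i, v i) • x := by
    intro v
    ext j
    simp [Matrix.vecMul, dotProduct, mul_sub, Finset.sum_sub_distrib, Finset.sum_mul]
  constructor
  · rintro ⟨v, hv0, h⟩
    rw [hv] at h
    by_cases hs : ∑ i, v i = 0
    · exfalso
      apply hv0
      ext i
      rw [hs, zero_smul, sub_zero] at h
      exact hq.eq_zero_of_sum_eq_zero hs h i (Finset.mem_univ _)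
    · have hw : ∑ i, (∑ i, v i)⁻¹ * v i = 1 := by
        rw [← Finset.mul_sum, inv_mul_cancel₀ hs]
      have := affineCombination_mem_affineSpan hw q
      rw [Finset.affineCombination_eq_linear_combination _ _ _ hw] at this
      convert this
      simp_rw [mul_smul]
      rw [← Finset.smul_sum, sub_eq_zero.1 h, smul_smul, inv_mul_cancel₀ hs, one_smul]
  · intro h
    obtain ⟨w, hw, rfl⟩ := eq_affineCombination_of_mem_affineSpan_of_fintype h
    refine ⟨w, ?_, ?_⟩
    · rintro rfl
      simp at hw
    · rw [hv, hw, one_smul, Finset.affineCombination_eq_linear_combination _ _ _ hw, sub_self]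

theorem finrank_dir {d : ℕ} (hd : 0 < d) (q : Fin d → (Fin d → ℝ)) (hq : AffineIndependent ℝ q) :
    Module.finrank ℝ (affineSpan ℝ (Set.range q)).direction = d - 1 := by
  obtain ⟨n, rfl⟩ : ∃ n, d = n + 1 := ⟨d - 1, by omega⟩
  rw [direction_affineSpan, hq.finrank_vectorSpan (n := n) (by simp)]
  rfl

theorem exists_Dmap_ne {d : ℕ} (hd : 0 < d) (q : Fin d → (Fin d → ℝ)) (hq : AffineIndependent ℝ q) :
    ∃ x, Dmap q x ≠ 0 := by
  by_contra hc
  push Not at hc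
  have h : affineSpan ℝ (Set.range q) = ⊤ := by
    ext x
    simp [← zero_iff_mem q hq, hc]
  have h2 := finrank_dir hd q hq
  rw [h, AffineSubspace.direction_top, finrank_top, Module.finrank_fin_fun] at h2
  omega

theorem coefD_ne {d : ℕ} (hd : 0 < d) (q : Fin d → (Fin d → ℝ)) (hq : AffineIndependent ℝ q) :
    coefD q ≠ 0 := by
  intro h
  obtain ⟨x, hx⟩ := exists_Dmap_ne hd q hq
  apply hx
  rw [Dmap_eq, h]
  simp [affEval]

theorem affEval_smul {d : ℕ} (c : ℝ) (g : (Fin d → ℝ) × ℝ) (x : Fin d → ℝ) :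
    affEval (c • g) x = c * affEval g x := by
  simp [affEval, mul_add]

theorem affEval_sub {d : ℕ} (g h : (Fin d → ℝ) × ℝ) (x : Fin d → ℝ) :
    affEval (g - h) x = affEval g x - affEval h x := by
  simp [affEval]; ring

theorem affEval_comb {d : ℕ} (g : (Fin d → ℝ) × ℝ) (a b : ℝ) (hab : a + b = 1)
    (x y : Fin d → ℝ) :
    affEval g (a • x + b • y) = a * affEval g x + b * affEval g y := by
  simp only [affEval, dotProduct_add, dotProduct_smul, smul_eq_mul]
  linear_combination (-g.2) * hab

theorem eq_smul_coefD {d : ℕ} (hd : 0 < d) (q : Fin d → (Fin d → ℝ)) (hq : AffineIndependent ℝ q)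
    (g : (Fin d → ℝ) × ℝ) (hg : ∀ i, affEval g (q i) = 0) : ∃ c : ℝ, g = c • coefD q := by
  obtain ⟨x, hx⟩ := exists_Dmap_ne hd q hq
  refine ⟨affEval g x / Dmap q x, ?_⟩
  set h := g - (affEval g x / Dmap q x) • coefD q with hh
  have hx0 : affEval h x = 0 := by
    rw [hh, affEval_sub, affEval_smul, ← Dmap_eq]
    field_simp
    ring
  have hq0 : ∀ i, affEval h (q i) = 0 := by
    intro i
    rw [hh, affEval_sub, affEval_smul, ← Dmap_eq, Dmap_self, hg]
    ring
  have h1 : h.1 = 0 := by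
    apply Matrix.eq_zero_of_mulVec_eq_zero hx
    ext i
    have e1 := hq0 i
    unfold affEval at e1 hx0
    simp only [Matrix.mulVec, Matrix.of_apply, Pi.zero_apply]
    have : (fun j => q i j - x j) = q i - x := rfl
    rw [this, dotProduct_comm, dotProduct_sub]
    linarith
  have h2 : h.2 = 0 := by
    simpa [affEval, h1] using hx0
  have h3 : h = 0 := Prod.ext h1 h2
  exact sub_eq_zero.1 (hh ▸ h3)

theorem path_lemma {d : ℕ} (hd : 0 < d) (P : Fin d → Set (Fin d → ℝ))
    (hws : WellSeparated P) (q : ℝ → Fin d → (Fin d → ℝ)) (g : ℝ → (Fin d → ℝ) × ℝ)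
    (hqc : ContinuousOn q (Set.Icc 0 1)) (hgc : Continuous g)
    (hq : ∀ s ∈ Set.Icc (0:ℝ) 1, ∀ i, q s i ∈ convexHull ℝ (P i))
    (hg0 : ∀ s ∈ Set.Icc (0:ℝ) 1, g s ≠ 0)
    (hg : ∀ s ∈ Set.Icc (0:ℝ) 1, ∀ i, affEval (g s) (q s i) = 0)
    (h0 : 0 < affIn (coefD (q 0)) (g 0)) : 0 < affIn (coefD (q 1)) (g 1) := by
  by_contra hc
  have hcont : ContinuousOn (fun s => affIn (coefD (q s)) (g s)) (Set.Icc 0 1) := by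
    have h1 : ContinuousOn (fun s => coefD (q s)) (Set.Icc 0 1) :=
      continuous_coefD.comp_continuousOn hqc
    have h2 : Continuous fun z : ((Fin d → ℝ) × ℝ) × ((Fin d → ℝ) × ℝ) => affIn z.1 z.2 := by
      unfold affIn dotProduct
      fun_prop
    exact h2.comp_continuousOn (h1.prodMk hgc.continuousOn)
  obtain ⟨s, hs, hs0⟩ := intermediate_value_Icc' (zero_le_one' ℝ) hcont
    (Set.mem_Icc.2 ⟨not_lt.1 hc, h0.le⟩)
  have hai := affineInd_of_ws hd P hws (q s) (hq s hs)
  obtain ⟨c, hcg⟩ := eq_smul_coefD hd (q s) hai (g s) (hg s hs)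
  have hc0 : c ≠ 0 := by
    rintro rfl
    exact hg0 s hs (by simpa using hcg)
  have hpos := affIn_self_pos _ (coefD_ne hd (q s) hai)
  have : affIn (coefD (q s)) (g s) = c * affIn (coefD (q s)) (coefD (q s)) := by
    rw [hcg]
    simp [affIn]
    ring
  simp only at hs0
  rw [this] at hs0
  exact (mul_ne_zero hc0 hpos.ne') hs0

theorem zero_path {d : ℕ} (C : Set (Fin d → ℝ)) (hC : Convex ℝ C) (f f' : (Fin d → ℝ) × ℝ)
    (a b : Fin d → ℝ) (ha : a ∈ C) (hb : b ∈ C)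
    (ha1 : affEval f a ≤ 0) (ha2 : 0 ≤ affEval f' a)
    (hb1 : 0 ≤ affEval f b) (hb2 : affEval f' b ≤ 0) :
    ∃ r : ℝ → (Fin d → ℝ), ContinuousOn r (Set.Icc 0 1) ∧ ∀ s ∈ Set.Icc (0:ℝ) 1, r s ∈ C ∧
      (1 - s) * affEval f (r s) - s * affEval f' (r s) = 0 := by
  have comm : (∃ x ∈ C, affEval f x = 0 ∧ affEval f' x = 0) → ∃ r : ℝ → (Fin d → ℝ),
      ContinuousOn r (Set.Icc 0 1) ∧ ∀ s ∈ Set.Icc (0:ℝ) 1, r s ∈ C ∧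
      (1 - s) * affEval f (r s) - s * affEval f' (r s) = 0 := by
    rintro ⟨x, hx, h1, h2⟩
    exact ⟨fun _ => x, continuousOn_const, fun s _ => ⟨hx, by simp [h1, h2]⟩⟩
  by_cases h1 : affEval f b - affEval f a = 0
  · have e1 : affEval f a = 0 := by linarith
    have e2 : affEval f b = 0 := by linarith
    apply comm
    by_cases h2 : affEval f' a - affEval f' b = 0
    · exact ⟨a, ha, e1, by linarith⟩
    · have h2' : 0 < affEval f' a - affEval f' b := lt_of_le_of_ne (by linarith) (Ne.symm h2)
      have hs : -affEval f' b / (affEval f' a - affEval f' b) +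
        affEval f' a / (affEval f' a - affEval f' b) = 1 := by field_simp; ring
      refine ⟨_, hC ha hb (div_nonneg (by linarith) h2'.le) (div_nonneg ha2 h2'.le) hs, ?_, ?_⟩
      · rw [affEval_comb _ _ _ hs, e1, e2]; simp
      · rw [affEval_comb _ _ _ hs]; field_simp; ring
  have h1' : 0 < affEval f b - affEval f a := lt_of_le_of_ne (by linarith) (Ne.symm h1)
  by_cases h2 : affEval f' a - affEval f' b = 0
  · have e1 : affEval f' a = 0 := by linarith
    have e2 : affEval f' b = 0 := by linarith
    apply comm
    have hs : affEval f b / (affEval f b - affEval f a) +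
        -affEval f a / (affEval f b - affEval f a) = 1 := by field_simp; ring
    refine ⟨_, hC ha hb (div_nonneg (by linarith) h1'.le) (div_nonneg (by linarith) h1'.le) hs,
      ?_, ?_⟩
    · rw [affEval_comb _ _ _ hs]; field_simp; ring
    · rw [affEval_comb _ _ _ hs, e1, e2]; simp
  have h2' : 0 < affEval f' a - affEval f' b := lt_of_le_of_ne (by linarith) (Ne.symm h2)
  set B : ℝ → ℝ := fun s => (1 - s) * affEval f b - s * affEval f' b with hB
  set A : ℝ → ℝ := fun s => -((1 - s) * affEval f a - s * affEval f' a) with hA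
  have hBn : ∀ s ∈ Set.Icc (0:ℝ) 1, 0 ≤ B s := by
    intro s hs
    have := mul_nonneg (sub_nonneg.2 hs.2) hb1
    have := mul_nonneg hs.1 (neg_nonneg.2 hb2)
    simp only [hB]; linarith
  have hAn : ∀ s ∈ Set.Icc (0:ℝ) 1, 0 ≤ A s := by
    intro s hs
    have := mul_nonneg (sub_nonneg.2 hs.2) (neg_nonneg.2 ha1)
    have := mul_nonneg hs.1 ha2
    simp only [hA]; linarith
  have hAB : ∀ s ∈ Set.Icc (0:ℝ) 1, 0 < B s + A s := by
    intro s hs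
    have e : B s + A s = (1 - s) * (affEval f b - affEval f a) +
      s * (affEval f' a - affEval f' b) := by simp only [hA, hB]; ring
    rw [e]
    rcases hs.1.eq_or_lt with h | h
    · rw [← h]; simpa using h1'
    · have := mul_nonneg (sub_nonneg.2 hs.2) h1'.le
      have := mul_pos h h2'
      linarith
  have hBc : Continuous B := by simp only [hB]; fun_prop
  have hAc : Continuous A := by simp only [hA]; fun_prop
  refine ⟨fun s => (B s / (B s + A s)) • a + (A s / (B s + A s)) • b, ?_, fun s hs => ?_⟩
  · have k1 : ContinuousOn (fun s => B s / (B s + A s)) (Set.Icc 0 1) :=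
      hBc.continuousOn.div (hBc.add hAc).continuousOn fun s hs => (hAB s hs).ne'
    have k2 : ContinuousOn (fun s => A s / (B s + A s)) (Set.Icc 0 1) :=
      hAc.continuousOn.div (hBc.add hAc).continuousOn fun s hs => (hAB s hs).ne'
    exact (k1.smul continuousOn_const).add (k2.smul continuousOn_const)
  · have hpos := hAB s hs
    have hsum : B s / (B s + A s) + A s / (B s + A s) = 1 := by field_simp
    refine ⟨hC ha hb (div_nonneg (hBn s hs) hpos.le) (div_nonneg (hAn s hs) hpos.le) hsum, ?_⟩
    rw [affEval_comb _ _ _ hsum, affEval_comb _ _ _ hsum]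
    field_simp
    simp only [hA, hB]
    ring

theorem key_lemma {d : ℕ} (hd : 0 < d) (P : Fin d → Set (Fin d → ℝ))
    (hws : WellSeparated P) (p p' : Fin d → (Fin d → ℝ))
    (hp : ∀ i, p i ∈ P i) (hp' : ∀ i, p' i ∈ P i)
    (ha : ∀ i, ∃ a ∈ P i, Dmap p a ≤ 0 ∧ 0 ≤ Dmap p' a)
    (hb : ∀ i, ∃ b ∈ P i, 0 ≤ Dmap p b ∧ Dmap p' b ≤ 0) :
    ∃ c : ℝ, 0 < c ∧ ∀ x, Dmap p x = c * Dmap p' x := by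
  have hpC : ∀ i, p i ∈ convexHull ℝ (P i) := fun i => subset_convexHull ℝ _ (hp i)
  have hpC' : ∀ i, p' i ∈ convexHull ℝ (P i) := fun i => subset_convexHull ℝ _ (hp' i)
  have hn := coefD_ne hd p (affineInd_of_ws hd P hws p hpC)
  have hn' := coefD_ne hd p' (affineInd_of_ws hd P hws p' hpC')
  by_cases hz : ∃ s ∈ Set.Icc (0:ℝ) 1, (1 - s) • coefD p - s • coefD p' = 0
  · obtain ⟨s, hs, h⟩ := hz
    have hs0 : s ≠ 0 := by
      rintro rfl
      exact hn (by simpa using h)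
    have hs1 : s ≠ 1 := by
      rintro rfl
      exact hn' (by simpa using h)
    have h0 : 0 < s := lt_of_le_of_ne hs.1 (Ne.symm hs0)
    have h1 : 0 < 1 - s := sub_pos.2 (lt_of_le_of_ne hs.2 hs1)
    refine ⟨s / (1 - s), div_pos h0 h1, fun x => ?_⟩
    have := congrArg (fun g => affEval g x) h
    simp only [affEval_sub, affEval_smul, ← Dmap_eq] at this
    have h3 : affEval (0 : (Fin d → ℝ) × ℝ) x = 0 := by simp [affEval]
    rw [h3] at this
    field_simp
    linarith
  · exfalso
    push Not at hz
    choose a haP ha1 ha2 using ha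
    choose b hbP hb1 hb2 using hb
    simp only [Dmap_eq] at ha1 ha2 hb1 hb2
    have hex := fun i => zero_path (convexHull ℝ (P i)) (convex_convexHull ℝ _) (coefD p) (coefD p')
      (a i) (b i) (subset_convexHull ℝ _ (haP i)) (subset_convexHull ℝ _ (hbP i))
      (ha1 i) (ha2 i) (hb1 i) (hb2 i)
    choose r hrc hr using hex
    have hI0 : (0:ℝ) ∈ Set.Icc (0:ℝ) 1 := by simp
    have hI1 : (1:ℝ) ∈ Set.Icc (0:ℝ) 1 := by simp
    have seg : ∀ (x y : Fin d → (Fin d → ℝ)) (g : (Fin d → ℝ) × ℝ), g ≠ 0 →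
        (∀ i, x i ∈ convexHull ℝ (P i)) → (∀ i, y i ∈ convexHull ℝ (P i)) →
        (∀ i, affEval g (x i) = 0) → (∀ i, affEval g (y i) = 0) →
        0 < affIn (coefD x) g → 0 < affIn (coefD y) g := by
      intro x y g hg hx hy hgx hgy h0
      have := path_lemma hd P hws (fun s i => (1 - s) • x i + s • y i) (fun _ => g)
        (by fun_prop) continuous_const
        (fun s hs i => (convex_convexHull ℝ (P i)) (hx i) (hy i) (sub_nonneg.2 hs.2) hs.1 (by ring))
        (fun _ _ => hg)
        (fun s hs i => by rw [affEval_comb _ _ _ (by ring), hgx, hgy]; simp)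
        (by simpa using h0)
      simpa using this
    have st1 : 0 < affIn (coefD fun i => r i 0) (coefD p) := by
      refine seg p (fun i => r i 0) (coefD p) hn hpC (fun i => (hr i 0 hI0).1) ?_ ?_
        (affIn_self_pos _ hn)
      · intro i; rw [← Dmap_eq, Dmap_self]
      · intro i; simpa using (hr i 0 hI0).2
    have st2 := path_lemma hd P hws (fun s i => r i s)
      (fun s => (1 - s) • coefD p - s • coefD p')
      (continuousOn_pi.2 hrc) (by fun_prop) (fun s hs i => (hr i s hs).1) hz
      (fun s hs i => by rw [affEval_sub, affEval_smul, affEval_smul]; exact (hr i s hs).2)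
      (by simpa using st1)
    simp only [sub_self, zero_smul, one_smul, zero_sub] at st2
    have neg_eval : ∀ x, affEval (-coefD p') x = - affEval (coefD p') x := by
      intro x
      simp [affEval]
      ring
    have st3 := seg (fun i => r i 1) p' (-coefD p') (neg_ne_zero.2 hn')
      (fun i => (hr i 1 hI1).1) hpC' (fun i => by
        have := (hr i 1 hI1).2
        rw [neg_eval]; linarith)
      (fun i => by rw [neg_eval, ← Dmap_eq, Dmap_self, neg_zero]) st2
    have := affIn_self_pos _ hn'
    have e : affIn (coefD p') (-coefD p') = - affIn (coefD p') (coefD p') := by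
      simp [affIn]; ring
    linarith

theorem cut_points {d : ℕ} (P : Fin d → Set (Fin d → ℝ))
    (hfin : ∀ i, (P i).Finite) (α : Fin d → ℤ) (p p' : Fin d → (Fin d → ℝ))
    (h : IsAlphaCut P α p) (h' : IsAlphaCut P α p') (i : Fin d) :
    ∃ a ∈ P i, Dmap p a ≤ 0 ∧ 0 ≤ Dmap p' a := by
  by_contra hc
  push Not at hc
  have hsub : {q ∈ P i | 0 ≤ Dmap p' q} ⊆ {q ∈ P i | 0 < Dmap p q} := by
    rintro q ⟨hq, h0⟩
    refine ⟨hq, ?_⟩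
    by_contra hn
    exact absurd (hc q hq (not_lt.1 hn)) (not_lt.2 h0)
  have := Set.ncard_le_ncard hsub ((hfin i).subset (Set.sep_subset _ _))
  have h1 := (h i).1
  have h2 := (h' i).2
  omega

theorem cut_unique {d : ℕ} (hd : 0 < d) (P : Fin d → Set (Fin d → ℝ))
    (hfin : ∀ i, (P i).Finite) (hws : WellSeparated P) (α : Fin d → ℤ)
    (p p' : Fin d → (Fin d → ℝ)) (hp : ∀ i, p i ∈ P i) (hp' : ∀ i, p' i ∈ P i)
    (h : IsAlphaCut P α p) (h' : IsAlphaCut P α p') :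
    ∃ c : ℝ, 0 < c ∧ ∀ x, Dmap p x = c * Dmap p' x :=
  key_lemma hd P hws p p' hp hp' (cut_points P hfin α p p' h h') (fun i => by
    obtain ⟨a, h1, h2, h3⟩ := cut_points P hfin α p' p h' h i
    exact ⟨a, h1, h3, h2⟩)

theorem cut_exists {d : ℕ} (hd : 0 < d) (P : Fin d → Set (Fin d → ℝ))
    (hfin : ∀ i, (P i).Finite) (hws : WellSeparated P)
    (α : Fin d → ℤ) (hα : ∀ i, 1 ≤ α i ∧ α i ≤ ((P i).ncard : ℤ)) :
    ∃ p : Fin d → (Fin d → ℝ), (∀ i, p i ∈ P i) ∧ IsAlphaCut P α p := by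
  classical
  obtain ⟨e, he⟩ : ∃ e : (Fin d → ℝ) → Lex (Fin d → ℝ), Function.Injective e :=
    ⟨toLex, toLex.injective⟩
  let S : (Fin d → (Fin d → ℝ)) → Fin d → Set (Fin d → ℝ) := fun p i =>
    {q ∈ P i | 0 < Dmap p q ∨ (Dmap p q = 0 ∧ e q ≤ e (p i))}
  have hSfin : ∀ p i, (S p i).Finite := fun p i => (hfin i).subset (Set.sep_subset _ _)
  have hcut : ∀ p : Fin d → (Fin d → ℝ), (∀ i, p i ∈ P i) →
      IsAlphaCut P (fun i => ((S p i).ncard : ℤ)) p := by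
    intro p hp i
    constructor
    · have : {q ∈ P i | 0 < Dmap p q} ⊂ S p i := by
        refine (Set.ssubset_iff_of_subset ?_).2 ⟨p i, ⟨hp i, Or.inr ⟨Dmap_self p i, le_rfl⟩⟩, ?_⟩
        · rintro q ⟨h1, h2⟩
          exact ⟨h1, Or.inl h2⟩
        · rintro ⟨_, h2⟩
          rw [Dmap_self] at h2
          exact lt_irrefl _ h2
      have := Set.ncard_lt_ncard this (hSfin p i)
      simp only
      omega
    · have : S p i ⊆ {q ∈ P i | 0 ≤ Dmap p q} := by
        rintro q ⟨h1, h2 | h2⟩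
        · exact ⟨h1, h2.le⟩
        · exact ⟨h1, h2.1.ge⟩
      have := Set.ncard_le_ncard this ((hfin i).subset (Set.sep_subset _ _))
      simp only
      omega
  have hSpos : ∀ p : Fin d → (Fin d → ℝ), (∀ i, p i ∈ P i) → ∀ i, (S p i).ncard - 1 < (P i).ncard := by
    intro p hp i
    have h1 := (hcut p hp i).1
    have := Set.ncard_le_ncard (s := S p i) (Set.sep_subset _ _) (hfin i)
    simp only at h1
    omega
  let φ : (∀ i, P i) → ∀ i, Fin (P i).ncard := fun p i =>
    ⟨(S (fun i => (p i : Fin d → ℝ)) i).ncard - 1, hSpos _ (fun i => (p i).2) i⟩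
  have hinj : Function.Injective φ := by
    intro p p' hpp
    set u : Fin d → (Fin d → ℝ) := fun i => p i with hu
    set u' : Fin d → (Fin d → ℝ) := fun i => p' i with hu'
    have hup : ∀ i, u i ∈ P i := fun i => (p i).2
    have hup' : ∀ i, u' i ∈ P i := fun i => (p' i).2
    have hc := hcut u hup
    have hc' := hcut u' hup'
    have hcard : ∀ i, (S u i).ncard = (S u' i).ncard := by
      intro i
      have h1 : (S u i).ncard - 1 = (S u' i).ncard - 1 := congrArg Fin.val (congrFun hpp i)
      have h2 := (hc i).1
      have h3 := (hc' i).1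
      simp only at h2 h3
      omega
    have hc2 : IsAlphaCut P (fun i => ((S u i).ncard : ℤ)) u' := by
      simpa only [hcard] using hc'
    obtain ⟨c, hc0, hcx⟩ := cut_unique hd P hfin hws _ u u' hup hup' hc hc2
    have hposiff : ∀ x, 0 < Dmap u x ↔ 0 < Dmap u' x := fun x => by
      rw [hcx]; exact mul_pos_iff_of_pos_left hc0
    have hzeroiff : ∀ x, Dmap u x = 0 ↔ Dmap u' x = 0 := fun x => by
      rw [hcx]; simp [hc0.ne']
    have hno : ∀ v v' : Fin d → (Fin d → ℝ), (∀ i, v' i ∈ P i) →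
        (∀ x, 0 < Dmap v x ↔ 0 < Dmap v' x) → (∀ x, Dmap v x = 0 ↔ Dmap v' x = 0) →
        ∀ i, (S v i).ncard = (S v' i).ncard → ¬ e (v i) < e (v' i) := by
      intro v v' hv' h1 h2 i hcd hlt
      have : S v i ⊂ S v' i := by
        refine (Set.ssubset_iff_of_subset ?_).2
          ⟨v' i, ⟨hv' i, Or.inr ⟨Dmap_self v' i, le_rfl⟩⟩, ?_⟩
        · rintro q ⟨k1, k2 | k2⟩
          · exact ⟨k1, Or.inl ((h1 q).1 k2)⟩
          · exact ⟨k1, Or.inr ⟨(h2 q).1 k2.1, k2.2.trans hlt.le⟩⟩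
        · rintro ⟨_, k2 | k2⟩
          · rw [h1, Dmap_self] at k2
            exact lt_irrefl _ k2
          · exact absurd k2.2 (not_le.2 hlt)
      have := Set.ncard_lt_ncard this (hSfin v' i)
      omega
    funext i
    apply Subtype.ext
    apply he
    exact le_antisymm
      (not_lt.1 (hno u' u hup (fun x => (hposiff x).symm) (fun x => (hzeroiff x).symm) i
        (hcard i).symm))
      (not_lt.1 (hno u u' hup' hposiff hzeroiff i (hcard i)))
  have : ∀ i, Fintype (P i) := fun i => (hfin i).fintype
  have hbij : Function.Bijective φ := by
    rw [Fintype.bijective_iff_injective_and_card]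
    refine ⟨hinj, ?_⟩
    rw [Fintype.card_pi, Fintype.card_pi]
    refine Finset.prod_congr rfl fun i _ => ?_
    rw [Fintype.card_fin, ← Nat.card_eq_fintype_card]
    rfl
  obtain ⟨p, hp⟩ := hbij.2 (fun i => ⟨(α i - 1).toNat, by have := hα i; omega⟩)
  refine ⟨fun i => p i, fun i => (p i).2, ?_⟩
  have hc := hcut (fun i => p i) (fun i => (p i).2)
  convert hc using 1
  funext i
  have h1 : (S (fun i => (p i : Fin d → ℝ)) i).ncard - 1 = (α i - 1).toNat :=
    congrArg Fin.val (congrFun hp i)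
  have h2 := (hc i).1
  have h3 := hα i
  simp only at h2
  omega

/-- The `α`-Ham Sandwich theorem without general position: for well-separated
nonempty finite point sets, (1) every colorful selection spans a hyperplane on
which `D_p` vanishes exactly; (2) an `α`-cut exists; (3) any two `α`-cuts
determine the same hyperplane. -/
theorem alphaHamSandwich_tieBreaking {d : ℕ}
    (P : Fin d → Set (Fin d → ℝ))
    (hfin : ∀ i, (P i).Finite) (hne : ∀ i, (P i).Nonempty)
    (hws : WellSeparated P)
    (α : Fin d → ℤ) (hα : ∀ i, 1 ≤ α i ∧ α i ≤ ((P i).ncard : ℤ)) :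
    (∀ p : Fin d → (Fin d → ℝ), (∀ i, p i ∈ P i) →
        Module.finrank ℝ (affineSpan ℝ (Set.range p)).direction = d - 1 ∧
        {x : Fin d → ℝ | Dmap p x = 0} =
          (affineSpan ℝ (Set.range p) : Set (Fin d → ℝ))) ∧
    (∃ p : Fin d → (Fin d → ℝ), (∀ i, p i ∈ P i) ∧ IsAlphaCut P α p) ∧
    (∀ p p' : Fin d → (Fin d → ℝ), (∀ i, p i ∈ P i) → (∀ i, p' i ∈ P i) →
        IsAlphaCut P α p → IsAlphaCut P α p' →
        {x : Fin d → ℝ | Dmap p x = 0} = {x : Fin d → ℝ | Dmap p' x = 0}) := by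
  rcases Nat.eq_zero_or_pos d with rfl | hd
  · refine ⟨fun p _ => ⟨?_, ?_⟩, ⟨fun i => i.elim0, fun i => i.elim0, fun i => i.elim0⟩,
      fun p p' _ _ _ _ => ?_⟩
    · simp [Set.range_eq_empty]
    · simp [Set.range_eq_empty, Dmap]
    · rw [Subsingleton.elim p p']
  · refine ⟨fun p hp => ?_, cut_exists hd P hfin hws α hα, fun p p' hp hp' h h' => ?_⟩
    · have hai := affineInd_of_ws hd P hws p fun i => subset_convexHull ℝ _ (hp i)
      exact ⟨finrank_dir hd p hai, Set.ext fun x => zero_iff_mem p hai x⟩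
    · obtain ⟨c, hc, hx⟩ := cut_unique hd P hfin hws α p p' hp hp' h h'
      ext x
      simp [hx, hc.ne']
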